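/- Let g : ℝ² → ℝ be smooth and compactly supported, and define Φ(x) = −(1/2π) ∫_{ℝ²} ln|x − x'| g(x') dx'. Then Φ is smooth on ℝ² and satisfies the Poisson equation ΔΦ = −g, where Δ = ∂_x² + ∂_y². -/

import Mathlib

open MeasureTheory Real
open scoped RealInnerProductSpace

noncomputable section

/-- The plane `ℝ²`. -/
abbrev V2 : Type := EuclideanSpace ℝ (Fin 2)

/-- Partial derivative in the `i`-th coordinate direction. -/
def pd (i : Fin 2) (f : V2 → ℝ) (x : V2) : ℝ :=
  fderiv ℝ f x (EuclideanSpace.single i 1)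

open Filter Topology Convolution

lemma contDiff_pd {f : V2 → ℝ} (hf : ContDiff ℝ (⊤ : ℕ∞) f) (i : Fin 2) :
    ContDiff ℝ (⊤ : ℕ∞) (pd i f) :=
  (hf.fderiv_right (m := (⊤ : ℕ∞)) (by simp)).clm_apply contDiff_const

lemma hasCompactSupport_pd {f : V2 → ℝ} (hf : HasCompactSupport f) (i : Fin 2) :
    HasCompactSupport (pd i f) :=
  hf.fderiv_apply ℝ _

lemma pd_const_mul (i : Fin 2) (c : ℝ) {f : V2 → ℝ} (hf : Differentiable ℝ f) :
    pd i (fun x => c * f x) = fun x => c * pd i f x := by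
  ext x
  simp [pd, fderiv_const_mul (hf x)]

lemma pd_comp_add_right (i : Fin 2) (f : V2 → ℝ) (a : V2) :
    pd i (fun x => f (x + a)) = fun x => pd i f (x + a) := by
  ext x
  simp [pd, fderiv_comp_add_right]

lemma pd_convolution {k g : V2 → ℝ} (hk : LocallyIntegrable k) (hg : ContDiff ℝ (⊤ : ℕ∞) g)
    (hgs : HasCompactSupport g) (i : Fin 2) :
    pd i (k ⋆[ContinuousLinearMap.mul ℝ ℝ] g) = k ⋆[ContinuousLinearMap.mul ℝ ℝ] pd i g := by
  ext x
  have hg1 : ContDiff ℝ 1 g := hg.of_le (by exact_mod_cast le_top)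
  rw [pd, (hgs.hasFDerivAt_convolution_right (ContinuousLinearMap.mul ℝ ℝ) hk hg1 x).fderiv,
    convolution_precompR_apply _ hk (hgs.fderiv ℝ) (hg1.continuous_fderiv one_ne_zero)]
  rfl

lemma locallyIntegrable_log_norm : LocallyIntegrable (fun y : V2 => log ‖y‖) := by
  have hmeas : Measurable (fun y : V2 => log ‖y‖) := by fun_prop
  have h1 : LocallyIntegrable (fun y : V2 => ‖y‖⁻¹) :=
    locallyIntegrable_of_norm_le_rpow (C := 1) (α := 1) (by simp) (by simp)
      (Eventually.of_forall fun y => by simp [Real.rpow_neg_one])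
      (by fun_prop)
  have h2 : LocallyIntegrable (fun y : V2 => ‖y‖) := continuous_norm.locallyIntegrable
  refine (h1.add h2).mono hmeas.aestronglyMeasurable (Eventually.of_forall fun y => ?_)
  simp only [Pi.add_apply, Real.norm_eq_abs]
  rw [abs_of_nonneg (a := ‖y‖⁻¹ + ‖y‖) (by positivity), abs_le]
  rcases (norm_nonneg y).eq_or_lt with h | h
  · simp [← h]
  · have h3 := Real.one_sub_inv_le_log_of_pos h
    have h4 := Real.log_le_sub_one_of_pos h
    have h5 : 0 < ‖y‖⁻¹ := by positivity
    constructor <;> linarith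

lemma integral_mul_pd {u f : V2 → ℝ} (hu : ContDiff ℝ (⊤ : ℕ∞) u) (hf : ContDiff ℝ (⊤ : ℕ∞) f)
    (hfs : HasCompactSupport f) (i : Fin 2) :
    ∫ y, u y * pd i f y = -∫ y, pd i u y * f y := by
  refine integral_mul_fderiv_eq_neg_fderiv_mul_of_integrable ?_ ?_ ?_
    (fun x _ => hu.differentiable (by simp) x) (fun x _ => hf.differentiable (by simp) x)
  · exact ((contDiff_pd hu i).continuous.mul hf.continuous).integrable_of_hasCompactSupport
      hfs.mul_left
  · exact (hu.continuous.mul (contDiff_pd hf i).continuous).integrable_of_hasCompactSupport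
      (hasCompactSupport_pd hfs i).mul_left
  · exact (hu.continuous.mul hf.continuous).integrable_of_hasCompactSupport hfs.mul_left

lemma integral_mul_pd_pd {u f : V2 → ℝ} (hu : ContDiff ℝ (⊤ : ℕ∞) u)
    (hf : ContDiff ℝ (⊤ : ℕ∞) f) (hfs : HasCompactSupport f) (i : Fin 2) :
    ∫ y, u y * pd i (pd i f) y = ∫ y, pd i (pd i u) y * f y := by
  rw [integral_mul_pd hu (contDiff_pd hf i) (hasCompactSupport_pd hfs i),
    integral_mul_pd (contDiff_pd hu i) hf hfs, neg_neg]

lemma contDiff_log_norm_sq_add {ε : ℝ} (hε : 0 < ε) :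
    ContDiff ℝ (⊤ : ℕ∞) (fun y : V2 => 1 / 2 * log (‖y‖ ^ 2 + ε)) :=
  contDiff_const.mul (((contDiff_norm_sq ℝ).add contDiff_const).log fun y => by positivity)

lemma pd_log_norm_sq_add {ε : ℝ} (hε : 0 < ε) (i : Fin 2) :
    pd i (fun y : V2 => 1 / 2 * log (‖y‖ ^ 2 + ε)) = fun y => y i / (‖y‖ ^ 2 + ε) := by
  ext y
  have h := (((hasStrictFDerivAt_norm_sq y).hasFDerivAt.add_const ε).log
    (by positivity)).const_mul (1 / 2)
  rw [pd, h.fderiv]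
  simp [EuclideanSpace.inner_single_right]
  field_simp

lemma pd_pd_log_norm_sq_add {ε : ℝ} (hε : 0 < ε) (i : Fin 2) (y : V2) :
    pd i (pd i fun y : V2 => 1 / 2 * log (‖y‖ ^ 2 + ε)) y =
      (‖y‖ ^ 2 + ε)⁻¹ - 2 * y i ^ 2 / (‖y‖ ^ 2 + ε) ^ 2 := by
  rw [pd_log_norm_sq_add hε]
  have hs : ‖y‖ ^ 2 + ε ≠ 0 := by positivity
  have h1 : HasFDerivAt (fun y : V2 => y i) (EuclideanSpace.proj i : V2 →L[ℝ] ℝ) y :=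
    (EuclideanSpace.proj i : V2 →L[ℝ] ℝ).hasFDerivAt
  have h2 : HasFDerivAt (fun y : V2 => (‖y‖ ^ 2 + ε)⁻¹) _ y := (hasDerivAt_inv hs).comp_hasFDerivAt y
    ((hasStrictFDerivAt_norm_sq y).hasFDerivAt.add_const ε)
  simp_rw [div_eq_mul_inv]
  rw [pd, (h1.fun_mul h2).fderiv]
  simp [EuclideanSpace.inner_single_right]
  field_simp
  ring

lemma laplacian_log_norm_sq_add {ε : ℝ} (hε : 0 < ε) (y : V2) :
    pd 0 (pd 0 fun y : V2 => 1 / 2 * log (‖y‖ ^ 2 + ε)) y +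
      pd 1 (pd 1 fun y : V2 => 1 / 2 * log (‖y‖ ^ 2 + ε)) y = 2 * ε / (‖y‖ ^ 2 + ε) ^ 2 := by
  have hs : ‖y‖ ^ 2 + ε ≠ 0 := by positivity
  have hn : ‖y‖ ^ 2 = y 0 ^ 2 + y 1 ^ 2 := by simp [EuclideanSpace.norm_sq_eq]
  rw [pd_pd_log_norm_sq_add hε, pd_pd_log_norm_sq_add hε]
  field_simp
  linear_combination (2 : ℝ) * hn

lemma integral_inv_one_add_norm_sq_sq : ∫ y : V2, ((1 + ‖y‖ ^ 2) ^ 2)⁻¹ = π := by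
  rw [integral_fun_norm_addHaar volume (fun r : ℝ => ((1 + r ^ 2) ^ 2)⁻¹)]
  have hvol : volume.real (Metric.ball (0 : V2) 1) = π := by
    simp [Measure.real, EuclideanSpace.volume_ball_fin_two, pi_pos.le]
  have hint : ∫ r in Set.Ioi (0 : ℝ), r * ((1 + r ^ 2) ^ 2)⁻¹ = 1 / 2 := by
    have hd : ∀ r : ℝ, HasDerivAt (fun r : ℝ => -(1 / 2) * (1 + r ^ 2)⁻¹)
        (r * ((1 + r ^ 2) ^ 2)⁻¹) r := fun r => by
      have := ((((hasDerivAt_id r).pow 2).const_add 1).inv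
        (by positivity : (1 : ℝ) + r ^ 2 ≠ 0)).const_mul (-(1 / 2))
      refine this.congr_deriv ?_
      simp
      field_simp
    have ht : Tendsto (fun r : ℝ => -(1 / 2) * (1 + r ^ 2)⁻¹) atTop (𝓝 (-(1 / 2) * 0)) :=
      (tendsto_inv_atTop_zero.comp (tendsto_atTop_add_const_left _ _
        (tendsto_pow_atTop two_ne_zero))).const_mul _
    rw [integral_Ioi_of_hasDerivAt_of_nonneg (hd 0).continuousAt.continuousWithinAt
      (fun r _ => hd r) (fun r hr => mul_nonneg (le_of_lt hr) (by positivity)) ht]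
    norm_num
  simp [hvol, hint]
  ring

lemma tendsto_integral_peak {f : V2 → ℝ} (hf : Continuous f) (hfs : HasCompactSupport f) :
    Tendsto (fun c : ℝ => ∫ y, (2 * (c ^ 2)⁻¹ / (‖y‖ ^ 2 + (c ^ 2)⁻¹) ^ 2) * f y)
      atTop (𝓝 (2 * π * f 0)) := by
  have key := tendsto_integral_comp_smul_smul_of_integrable (μ := (volume : Measure V2))
    (φ := fun y : V2 => π⁻¹ * ((1 + ‖y‖ ^ 2) ^ 2)⁻¹) (fun y => by positivity)
    (by rw [integral_const_mul, integral_inv_one_add_norm_sq_sq, inv_mul_cancel₀ pi_ne_zero])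
    (by
      have h : Tendsto (fun r : ℝ => π⁻¹ * (1 + r ^ 2)⁻¹) atTop (𝓝 (π⁻¹ * 0)) :=
        (tendsto_inv_atTop_zero.comp (tendsto_atTop_add_const_left _ _
          (tendsto_pow_atTop two_ne_zero))).const_mul _
      rw [mul_zero] at h
      refine squeeze_zero (fun y => by positivity) (fun y => ?_)
        (h.comp tendsto_norm_cobounded_atTop)
      simp only [finrank_euclideanSpace, Fintype.card_fin, Function.comp]
      rw [mul_left_comm]
      gcongr
      rw [← div_eq_mul_inv, div_le_iff₀ (by positivity)]
      field_simp
      linarith)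
    (hf.integrable_of_hasCompactSupport hfs) hf.continuousAt
  refine ((key.const_mul (2 * π)).congr' ?_)
  filter_upwards [eventually_gt_atTop 0] with c hc
  rw [← integral_const_mul]
  refine integral_congr_ae (Eventually.of_forall fun y => ?_)
  simp only [finrank_euclideanSpace, Fintype.card_fin, norm_smul, Real.norm_eq_abs, abs_of_pos hc,
    smul_eq_mul]
  field_simp
  ring

lemma abs_log_norm_sq_add_le {ε : ℝ} (hε : 0 < ε) (hε1 : ε ≤ 1) {y : V2} (hy : y ≠ 0) :
    |1 / 2 * log (‖y‖ ^ 2 + ε)| ≤ |log ‖y‖| + ‖y‖ ^ 2 := by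
  have hy' : 0 < ‖y‖ := norm_pos_iff.2 hy
  have h1 : log (‖y‖ ^ 2) ≤ log (‖y‖ ^ 2 + ε) := log_le_log (by positivity) (by linarith)
  have h2 := Real.log_le_sub_one_of_pos (x := ‖y‖ ^ 2 + ε) (by positivity)
  rw [Real.log_pow] at h1
  push_cast at h1
  rw [abs_le]
  constructor
  · nlinarith [neg_abs_le (log ‖y‖)]
  · nlinarith [abs_nonneg (log ‖y‖)]

lemma tendsto_integral_log_norm_sq_add {h : V2 → ℝ} (hh : Continuous h)
    (hhs : HasCompactSupport h) :
    Tendsto (fun c : ℝ => ∫ y : V2, (1 / 2 * log (‖y‖ ^ 2 + (c ^ 2)⁻¹)) * h y) atTop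
      (𝓝 (∫ y : V2, log ‖y‖ * h y)) := by
  have hne : ∀ᵐ y : V2, y ≠ 0 := Measure.ae_ne volume 0
  have hli : LocallyIntegrable (fun y : V2 => |log ‖y‖| + ‖y‖ ^ 2) :=
    (locallyIntegrable_log_norm.mono
      locallyIntegrable_log_norm.aestronglyMeasurable.norm (by simp)).add
      (continuous_norm.pow 2).locallyIntegrable
  refine tendsto_integral_filter_of_dominated_convergence
    (fun y => (|log ‖y‖| + ‖y‖ ^ 2) * ‖h y‖) ?_ ?_ ?_ ?_
  · exact Eventually.of_forall fun c => by
      have := hh.measurable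
      exact Measurable.aestronglyMeasurable (by fun_prop)
  · filter_upwards [eventually_ge_atTop 1] with c hc
    filter_upwards [hne] with y hy
    rw [norm_mul]
    gcongr
    exact abs_log_norm_sq_add_le (by positivity) (inv_le_one_of_one_le₀ (one_le_pow₀ hc)) hy
  · exact hli.integrable_smul_right_of_hasCompactSupport hh.norm hhs.norm
  · filter_upwards [hne] with y hy
    have hy' : ‖y‖ ^ 2 + 0 ≠ 0 := by simpa using hy
    have h1 : Tendsto (fun c : ℝ => ‖y‖ ^ 2 + (c ^ 2)⁻¹) atTop (𝓝 (‖y‖ ^ 2 + 0)) :=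
      (tendsto_inv_atTop_zero.comp (tendsto_pow_atTop two_ne_zero)).const_add _
    have h2 := ((h1.log hy').const_mul (1 / 2)).mul_const (h y)
    convert h2 using 2
    rw [add_zero, Real.log_pow]
    push_cast
    ring

/-- The logarithm is `2π` times the fundamental solution of the planar Laplacian. -/
lemma integral_log_norm_mul_laplacian {f : V2 → ℝ} (hf : ContDiff ℝ (⊤ : ℕ∞) f)
    (hfs : HasCompactSupport f) :
    ∫ y : V2, log ‖y‖ * (pd 0 (pd 0 f) y + pd 1 (pd 1 f) y) = 2 * π * f 0 := by
  have hc (i : Fin 2) : Continuous (pd i (pd i f)) := (contDiff_pd (contDiff_pd hf i) i).continuous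
  have hs (i : Fin 2) : HasCompactSupport (pd i (pd i f)) :=
    hasCompactSupport_pd (hasCompactSupport_pd hfs i) i
  refine tendsto_nhds_unique
    (tendsto_integral_log_norm_sq_add ((hc 0).add (hc 1)) ((hs 0).add (hs 1)))
    ((tendsto_integral_peak hf.continuous hfs).congr' ?_)
  filter_upwards [eventually_gt_atTop 0] with c hc0
  have hε : 0 < (c ^ 2)⁻¹ := by positivity
  have hu := contDiff_log_norm_sq_add hε
  have hint1 (i : Fin 2) : Integrable fun y : V2 =>
      (1 / 2 * log (‖y‖ ^ 2 + (c ^ 2)⁻¹)) * pd i (pd i f) y :=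
    (hu.continuous.mul (hc i)).integrable_of_hasCompactSupport (hs i).mul_left
  have hint2 (i : Fin 2) : Integrable fun y : V2 =>
      pd i (pd i fun y : V2 => 1 / 2 * log (‖y‖ ^ 2 + (c ^ 2)⁻¹)) y * f y :=
    ((contDiff_pd (contDiff_pd hu i) i).continuous.mul
      hf.continuous).integrable_of_hasCompactSupport hfs.mul_left
  simp only [mul_add]
  rw [integral_add (hint1 0) (hint1 1), integral_mul_pd_pd hu hf hfs, integral_mul_pd_pd hu hf hfs,
    ← integral_add (hint2 0) (hint2 1)]
  refine integral_congr_ae (Eventually.of_forall fun y => ?_)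
  simp only
  rw [← add_mul, laplacian_log_norm_sq_add hε]

/-- For smooth compactly supported `g`, the logarithmic potential
`Φ(x) = -(1/2π) ∫ ln|x-x'| g(x') dx'` is smooth and solves the Poisson equation
`ΔΦ = -g`. -/
theorem stmt7 (g : V2 → ℝ) (hg : ContDiff ℝ (⊤ : ℕ∞) g) (hgs : HasCompactSupport g)
    (Φ : V2 → ℝ)
    (hΦ : ∀ x : V2, Φ x = -(1 / (2 * π)) * ∫ x' : V2, Real.log ‖x - x'‖ * g x') :
    ContDiff ℝ (⊤ : ℕ∞) Φ ∧ ∀ x : V2, pd 0 (pd 0 Φ) x + pd 1 (pd 1 Φ) x = -g x := by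
  set k : V2 → ℝ := fun y => log ‖y‖
  have hk : LocallyIntegrable k := locallyIntegrable_log_norm
  have hΦ' : Φ = fun x => -(1 / (2 * π)) * (k ⋆[ContinuousLinearMap.mul ℝ ℝ] g) x := by
    ext x
    rw [hΦ, convolution_mul_swap]
  have hsmooth {h : V2 → ℝ} (hh : ContDiff ℝ (⊤ : ℕ∞) h) (hhs : HasCompactSupport h) :
      ContDiff ℝ (⊤ : ℕ∞) (k ⋆[ContinuousLinearMap.mul ℝ ℝ] h) :=
    hhs.contDiff_convolution_right _ hk hh
  refine ⟨hΦ' ▸ contDiff_const.mul (hsmooth hg hgs), fun x => ?_⟩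
  have hpd (i : Fin 2) : pd i (pd i Φ) x =
      -(1 / (2 * π)) * (k ⋆[ContinuousLinearMap.mul ℝ ℝ] pd i (pd i g)) x := by
    have hgi := contDiff_pd hg i
    have hgsi := hasCompactSupport_pd hgs i
    rw [hΦ', pd_const_mul i _ ((hsmooth hg hgs).differentiable (by simp)),
      pd_convolution hk hg hgs, pd_const_mul i _ ((hsmooth hgi hgsi).differentiable (by simp)),
      pd_convolution hk hgi hgsi]
  have hc (i : Fin 2) : Continuous (pd i (pd i g)) := (contDiff_pd (contDiff_pd hg i) i).continuous
  have hs (i : Fin 2) : HasCompactSupport (pd i (pd i g)) :=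
    hasCompactSupport_pd (hasCompactSupport_pd hgs i) i
  have hex (i : Fin 2) := (hs i).convolutionExists_right (ContinuousLinearMap.mul ℝ ℝ) hk (hc i) x
  have hmain : (k ⋆[ContinuousLinearMap.mul ℝ ℝ] (pd 0 (pd 0 g) + pd 1 (pd 1 g))) x =
      2 * π * g x := by
    have := integral_log_norm_mul_laplacian (f := fun y => g (y + x))
      (hg.comp (contDiff_id.add contDiff_const)) (hgs.comp_homeomorph (Homeomorph.addRight x))
    simp only [pd_comp_add_right, zero_add] at this
    rw [convolution_mul_swap, ← this, ← integral_add_right_eq_self _ x]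
    refine integral_congr_ae (Eventually.of_forall fun y => ?_)
    simp [k]
  rw [hpd, hpd, ← mul_add, ← (hex 0).distrib_add (hex 1), hmain]
  field_simp
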